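/- Let X be a regular T1 space and Y ⊆ X. Then cl^{ωN}_X(Y) is ωN-closed in X, that is, cl^{ωN}_X(cl^{ωN}_X(Y)) = cl^{ωN}_X(Y). -/

import Mathlib

open Set Topology Filter

/-- `cl^{ωN}_X(Y)`: the union of the closures of all countable subsets of `Y` that are
nowhere dense in `X`. -/
def clOmegaN {X : Type*} [TopologicalSpace X] (Y : Set X) : Set X :=
  ⋃ A ∈ {A : Set X | A ⊆ Y ∧ A.Countable ∧ IsNowhereDense A}, closure A

theorem mem_clOmegaN {X : Type*} [TopologicalSpace X] {Y : Set X} {x : X} :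
    x ∈ clOmegaN Y ↔ ∃ A ⊆ Y, A.Countable ∧ IsNowhereDense A ∧ x ∈ closure A := by
  simp [clOmegaN, and_assoc]

theorem IsNowhereDense.union_of_isNowhereDense {X : Type*} [TopologicalSpace X] {s t : Set X}
    (hs : IsNowhereDense s) (ht : IsNowhereDense t) : IsNowhereDense (s ∪ t) := by
  rw [IsNowhereDense] at *
  rw [closure_union, interior_union_isClosed_of_interior_empty isClosed_closure ht, hs]

theorem isNowhereDense_biUnion_finite {X ι : Type*} [TopologicalSpace X] {S : Set ι}
    (hS : S.Finite) {B : ι → Set X} (hB : ∀ i, IsNowhereDense (B i)) :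
    IsNowhereDense (⋃ i ∈ S, B i) := by
  induction S, hS using Set.Finite.induction_on with
  | empty => simp [isNowhereDense_empty]
  | insert _ _ ih =>
    rw [biUnion_insert]
    exact (hB _).union_of_isNowhereDense ih

/-- Countable nowhere dense sets can be shrunk, keeping their accumulation on a closed nowhere
dense set `F`, so that their union becomes nowhere dense. -/
theorem exists_subset_isNowhereDense_iUnion {X : Type*} [TopologicalSpace X] [RegularSpace X]
    {F : Set X} (hFc : IsClosed F) (hF : IsNowhereDense F) {B : ℕ → Set X}
    (hBc : ∀ n, (B n).Countable) (hB : ∀ n, IsNowhereDense (B n)) :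
    ∃ C : ℕ → Set X, (∀ n, C n ⊆ B n) ∧ IsNowhereDense (⋃ n, C n) ∧
      ∀ n, F ∩ closure (B n) ⊆ closure (C n) := by
  rcases isEmpty_or_nonempty X with hX | hX
  · refine ⟨B, fun n => Subset.rfl, ?_, fun n => inter_subset_right⟩
    exact eq_empty_of_isEmpty _
  obtain ⟨d, hd⟩ := countable_iff_exists_subset_range.1 (countable_iUnion hBc)
  have hO : ∀ k, ∃ O : Set X, IsOpen O ∧ (d k ∉ F → d k ∈ O) ∧ Disjoint (closure O) F := by
    intro k
    by_cases hk : d k ∈ F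
    · exact ⟨∅, isOpen_empty, fun h => (h hk).elim, by simp⟩
    · obtain ⟨K, ⟨hK, hKc⟩, hKF⟩ :=
        (closed_nhds_basis (d k)).mem_iff.1 (hFc.isOpen_compl.mem_nhds hk)
      refine ⟨interior K, isOpen_interior, fun _ => mem_interior_iff_mem_nhds.2 hK, ?_⟩
      exact disjoint_left.2 fun y hy => hKF (closure_minimal interior_subset hKc hy)
  choose O hOo hdO hOF using hO
  let U : ℕ → Set X := fun n => (⋃ k ∈ Iio n, closure (O k))ᶜ
  have hU : ∀ n, IsOpen (U n) := fun n =>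
    ((finite_Iio n).isClosed_biUnion fun _ _ => isClosed_closure).isOpen_compl
  have hFU : ∀ n, F ⊆ U n := by
    intro n y hy hn
    obtain ⟨k, -, hk⟩ := mem_iUnion₂.1 hn
    exact disjoint_left.1 (hOF k) hk hy
  refine ⟨fun n => U n ∩ B n, fun n => inter_subset_right, ?_, ?_⟩
  · by_contra hne
    obtain ⟨y, hy, hyF⟩ : (interior (closure (⋃ n, U n ∩ B n)) \ F).Nonempty := by
      rw [sdiff_nonempty]
      intro hsub
      have := interior_maximal (hsub.trans subset_closure) isOpen_interior
      rw [hF] at this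
      exact hne (subset_empty_iff.1 this)
    obtain ⟨z, ⟨hzW, hzF⟩, hz⟩ := mem_closure_iff.1 (interior_subset hy) _
      (isOpen_interior.sdiff hFc) ⟨hy, hyF⟩
    obtain ⟨k, rfl⟩ := hd (iUnion_mono (fun n => inter_subset_right) hz)
    have hsub : interior (closure (⋃ n, U n ∩ B n)) ∩ O k ⊆
        closure (⋃ n ∈ Iic k, B n) := by
      rintro w ⟨hw, hwO⟩
      refine closure_mono ?_ ((hOo k).inter_closure ⟨hwO, interior_subset hw⟩)
      rintro v ⟨hvO, hv⟩
      obtain ⟨n, hvU, hvB⟩ := mem_iUnion.1 hv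
      refine mem_iUnion₂.2 ⟨n, mem_Iic.2 (not_lt.1 fun hkn => ?_), hvB⟩
      exact hvU (mem_iUnion₂.2 ⟨k, hkn, subset_closure hvO⟩)
    have := interior_maximal hsub (isOpen_interior.inter (hOo k)) ⟨hzW, hdO k hzF⟩
    rw [isNowhereDense_biUnion_finite (finite_Iic k) hB] at this
    exact this
  · rintro n y ⟨hyF, hyB⟩
    exact (hU n).inter_closure ⟨hFU n hyF, hyB⟩

/-- In a regular space, `cl^{ωN}_X(Y)` is ωN-closed in `X`. -/
theorem stmt12 {X : Type*} [TopologicalSpace X] [T1Space X] [RegularSpace X]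
    (Y : Set X) : clOmegaN (clOmegaN Y) = clOmegaN Y := by
  ext x
  constructor
  · intro hx
    obtain ⟨A, hAY, hAc, hA, hxA⟩ := mem_clOmegaN.1 hx
    have : Nonempty X := ⟨x⟩
    obtain ⟨a, ha⟩ := countable_iff_exists_subset_range.1 hAc
    have hB : ∀ n, ∃ B ⊆ Y, B.Countable ∧ IsNowhereDense B ∧ (a n ∈ A → a n ∈ closure B) := by
      intro n
      by_cases hn : a n ∈ A
      · obtain ⟨B, h₁, h₂, h₃, h₄⟩ := mem_clOmegaN.1 (hAY hn)
        exact ⟨B, h₁, h₂, h₃, fun _ => h₄⟩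
      · exact ⟨∅, empty_subset _, countable_empty, isNowhereDense_empty, fun h => (hn h).elim⟩
    choose B hBY hBc hBn haB using hB
    obtain ⟨C, hCB, hC, hFC⟩ :=
      exists_subset_isNowhereDense_iUnion isClosed_closure hA.closure hBc hBn
    refine mem_clOmegaN.2 ⟨⋃ n, C n, iUnion_subset fun n => (hCB n).trans (hBY n),
      countable_iUnion fun n => (hBc n).mono (hCB n), hC, ?_⟩
    refine closure_minimal ?_ isClosed_closure hxA
    intro y hy
    obtain ⟨n, rfl⟩ := ha hy
    exact closure_mono (subset_iUnion C n) (hFC n ⟨subset_closure hy, haB n hy⟩)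
  · intro hx
    obtain ⟨A, -, -, hA, hxA⟩ := mem_clOmegaN.1 hx
    exact mem_clOmegaN.2 ⟨{x}, singleton_subset_iff.2 hx, countable_singleton x,
      hA.closure.mono (singleton_subset_iff.2 hxA), subset_closure rfl⟩
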